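/- Let m ≥ 4 and let f be a Boolean function on m variables of degree m−3. If the homogeneous degree-(m−2) parts of the multilinear polynomials representing the pointwise products X₁·f, X₂·f, …, X_m·f are linearly independent over 𝔽₂ (equivalently, for every nonzero 𝔽₂-linear combination a of the variables X₁,…,X_m the pointwise product a·f has degree exactly m−2), then the minimum weight of the coset f + RM(m−4, m) is at least 2m+2; that is, for every Boolean function p of degree at most m−4, the weight of f + p is at least 2m+2. -/

import Mathlib

open MvPolynomial

/-- A Boolean function on `m` variables over 𝔽₂. -/
abbrev BF (m : ℕ) := (Fin m → ZMod 2) → ZMod 2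

/-- The unique multilinear polynomial over 𝔽₂ representing the Boolean function `f`
(obtained by interpolation: `∏ i (Xᵢ + vᵢ + 1)` is the indicator of the input `v`). -/
noncomputable def repPoly {m : ℕ} (f : BF m) : MvPolynomial (Fin m) (ZMod 2) :=
  ∑ v : Fin m → ZMod 2, f v • ∏ i : Fin m, (X i + C (v i + 1))

/-- The degree of a Boolean function: the total degree of its multilinear representative. -/
noncomputable def deg {m : ℕ} (f : BF m) : ℕ := (repPoly f).totalDegree

/-- The weight of a Boolean function: the number of inputs on which it takes the value 1. -/
noncomputable def wt {m : ℕ} (f : BF m) : ℕ :=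
  (Finset.univ.filter fun v => f v = 1).card

/-- The distance from `f` to the Reed–Muller code `RM(r,m)`: the minimum weight of
`f + p` over Boolean functions `p` of degree at most `r`. -/
noncomputable def distRM (m r : ℕ) (f : BF m) : ℕ :=
  sInf {w | ∃ p : BF m, deg p ≤ r ∧ wt (f + p) = w}

theorem eval_repPoly {m : ℕ} (f : BF m) (w : Fin m → ZMod 2) : eval w (repPoly f) = f w := by
  have hprod (v : Fin m → ZMod 2) : ∏ i, (w i + (v i + 1)) = if v = w then 1 else 0 := by
    split_ifs with h
    · subst h
      refine Finset.prod_eq_one fun i _ => ?_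
      rw [← add_assoc, CharTwo.add_self_eq_zero, zero_add]
    · obtain ⟨i, hi⟩ := Function.ne_iff.mp h
      refine Finset.prod_eq_zero (Finset.mem_univ i) ?_
      generalize v i = a at hi ⊢
      generalize w i = b at hi ⊢
      decide +revert
  simp [repPoly, smul_eval, hprod]

/-- Interpolation as a linear map. -/
noncomputable def repPolyLinear (m : ℕ) : BF m →ₗ[ZMod 2] MvPolynomial (Fin m) (ZMod 2) where
  toFun := repPoly
  map_add' f g := by simp [repPoly, add_smul, Finset.sum_add_distrib]
  map_smul' c f := by simp [repPoly, mul_smul, Finset.smul_sum]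

theorem repPoly_prod {m : ℕ} (T : Finset (Fin m)) :
    repPoly (fun v => ∏ i ∈ T, v i) = ∏ i ∈ T, X i := by
  have hsum (i : Fin m) :
      ∑ a : ZMod 2, (C (if i ∈ T then a else 1) * (X i + C (a + 1)) :
        MvPolynomial (Fin m) (ZMod 2)) = if i ∈ T then X i else 1 := by
    have huniv : (Finset.univ : Finset (ZMod 2)) = {0, 1} := rfl
    rw [huniv, Finset.sum_pair zero_ne_one, CharTwo.add_self_eq_zero]
    split_ifs
    · simp
    · simp only [C_1, C_0, zero_add, add_zero, one_mul]
      rw [add_right_comm, CharTwo.add_self_eq_zero, zero_add]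
  calc repPoly (fun v => ∏ i ∈ T, v i)
      = ∑ v : Fin m → ZMod 2, ∏ i, (C (if i ∈ T then v i else 1) * (X i + C (v i + 1))) := by
        refine Finset.sum_congr rfl fun v _ => ?_
        rw [Finset.prod_mul_distrib, ← map_prod, Finset.prod_ite_mem, Finset.univ_inter,
          smul_eq_C_mul]
    _ = ∏ i, ∑ a : ZMod 2, C (if i ∈ T then a else 1) * (X i + C (a + 1)) :=
        (Fintype.prod_sum fun i (a : ZMod 2) =>
          (C (if i ∈ T then a else 1) * (X i + C (a + 1)) : MvPolynomial (Fin m) (ZMod 2))).symm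
    _ = ∏ i ∈ T, X i := by
        simp_rw [hsum]
        rw [Finset.prod_ite_mem, Finset.univ_inter]

theorem deg_eval_le {m : ℕ} (q : MvPolynomial (Fin m) (ZMod 2)) :
    deg (fun v => eval v q) ≤ q.totalDegree := by
  have hq : (fun v => eval v q) =
      ∑ d ∈ q.support, q.coeff d • (fun v : Fin m → ZMod 2 => ∏ i ∈ d.support, v i) := by
    ext v
    rw [eval_eq, Finset.sum_apply]
    refine Finset.sum_congr rfl fun d _ => ?_
    rw [Pi.smul_apply, smul_eq_mul]
    congr 1
    refine Finset.prod_congr rfl fun i hi => ?_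
    have hpow (a : ZMod 2) {n : ℕ} (hn : n ≠ 0) : a ^ n = a := by
      obtain rfl | rfl : a = 0 ∨ a = 1 := by decide +revert
      · exact zero_pow hn
      · exact one_pow n
    exact hpow _ (Finsupp.mem_support_iff.mp hi)
  change (repPolyLinear m _).totalDegree ≤ _
  rw [hq, map_sum]
  refine totalDegree_finsetSum_le fun d hd => ?_
  rw [map_smul]
  refine (totalDegree_smul_le _ _).trans ?_
  change (repPoly _).totalDegree ≤ _
  rw [repPoly_prod]
  refine (totalDegree_finsetProd _ _).trans (le_trans ?_ (le_totalDegree hd))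
  refine Finset.sum_le_sum fun i hi => ?_
  rw [totalDegree_X]
  exact Nat.one_le_iff_ne_zero.mpr (Finsupp.mem_support_iff.mp hi)

theorem sum_eval_mul_eq_zero {m : ℕ} (g : BF m) (q : MvPolynomial (Fin m) (ZMod 2))
    (h : q.totalDegree + deg g < m) : ∑ v, eval v q * g v = 0 := by
  have := MvPolynomial.sum_eval_eq_zero (q * repPoly g)
    (by simpa using (totalDegree_mul q (repPoly g)).trans_lt h)
  simpa [eval_repPoly] using this

theorem deg_add_le {m : ℕ} (f g : BF m) : deg (f + g) ≤ max (deg f) (deg g) := by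
  change (repPolyLinear m (f + g)).totalDegree ≤ _
  rw [map_add]
  exact totalDegree_add _ _

/-- The coordinate functions together with the constant `1`, as polynomials. -/
noncomputable def affineCoord (m : ℕ) : Option (Fin m) → MvPolynomial (Fin m) (ZMod 2)
  | none => 1
  | some i => X i

theorem totalDegree_affineCoord_le {m : ℕ} (o : Option (Fin m)) :
    (affineCoord m o).totalDegree ≤ 1 := by
  cases o <;> simp [affineCoord]

/-- No nonzero affine function annihilates `f + p` when `deg p < deg f` and the products
`Xᵢ f` have linearly independent leading parts. -/
theorem eq_zero_of_affine_mul_eq_zero {m : ℕ} (hm : 4 ≤ m) {f p : BF m} (hdeg : deg f = m - 3)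
    (hind : LinearIndependent (ZMod 2)
      (fun i : Fin m => homogeneousComponent (m - 2) (repPoly (fun v => v i * f v))))
    (hp : deg p ≤ m - 4) (c : Option (Fin m) → ZMod 2)
    (hc : ∀ v, eval v (∑ o, c o • affineCoord m o) * (f + p) v = 0) : c = 0 := by
  have hlin : (∑ o, c o • affineCoord m o).totalDegree ≤ 1 :=
    totalDegree_finsetSum_le fun o _ =>
      (totalDegree_smul_le _ _).trans (totalDegree_affineCoord_le o)
  set q := C (c none) * repPoly f + (∑ o, c o • affineCoord m o) * repPoly p with hq
  have hqdeg : q.totalDegree ≤ m - 3 := by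
    refine (totalDegree_add _ _).trans (max_le ?_ ?_)
    · refine (totalDegree_mul _ _).trans ?_
      rw [totalDegree_C, zero_add]
      exact hdeg.le
    · refine (totalDegree_mul _ _).trans ?_
      change _ + deg p ≤ _
      omega
  have hfun : ∑ i : Fin m, c (some i) • (fun v : Fin m → ZMod 2 => v i * f v) =
      fun v => eval v q := by
    ext v
    have h := hc v
    simp only [hq, Fintype.sum_option, affineCoord, map_add, map_mul, map_sum, smul_eval, eval_C,
      eval_X, map_one, mul_one, eval_repPoly, Pi.add_apply, Finset.sum_apply, Pi.smul_apply,
      smul_eq_mul, ← mul_assoc, ← Finset.sum_mul] at h ⊢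
    linear_combination h - CharTwo.add_self_eq_zero
      (c none * f v + c none * p v + (∑ i, c (some i) * v i) * p v)
  have hcomp : ∑ i : Fin m, c (some i) •
      homogeneousComponent (m - 2) (repPoly (fun v => v i * f v)) = 0 := by
    calc _ = homogeneousComponent (m - 2) (repPolyLinear m
          (∑ i : Fin m, c (some i) • (fun v : Fin m → ZMod 2 => v i * f v))) := by
          simp only [map_sum, map_smul]
          rfl
      _ = 0 := by
          rw [hfun]
          refine homogeneousComponent_eq_zero _ _ ?_
          have : deg (fun v => eval v q) ≤ _ := deg_eval_le q
          change deg (fun v => eval v q) < _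
          omega
  have hsome := Fintype.linearIndependent_iff.mp hind _ hcomp
  have hnone : c none = 0 := by
    by_contra hne
    have hfp : f = fun v => eval v (-repPoly p) := by
      ext v
      have h := hc v
      simp only [Fintype.sum_option, hsome, zero_smul, Finset.sum_const_zero, add_zero,
        affineCoord, smul_eval, map_one, mul_one, Pi.add_apply] at h
      rw [map_neg, eval_repPoly]
      exact eq_neg_of_add_eq_zero_left ((mul_eq_zero.mp h).resolve_left hne)
    have h := deg_eval_le (-repPoly p)
    rw [← hfp, totalDegree_neg, hdeg] at h
    change _ ≤ deg p at h
    omega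
  ext o
  cases o with
  | none => exact hnone
  | some i => exact hsome i

/-- Theorem 3.2: if the degree-`(m-2)` parts of `X₁f, …, X_mf` are linearly independent,
then the coset `f + RM(m-4, m)` has minimum weight at least `2m + 2`. -/
theorem stmt1 (m : ℕ) (hm : 4 ≤ m) (f : BF m) (hdeg : deg f = m - 3)
    (hind : LinearIndependent (ZMod 2)
      (fun i : Fin m => homogeneousComponent (m - 2) (repPoly (fun v => v i * f v)))) :
    ∀ p : BF m, deg p ≤ m - 4 → 2 * m + 2 ≤ wt (f + p) := by
  intro p hp
  have hg : deg (f + p) ≤ m - 3 := (deg_add_le f p).trans (by omega)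
  have hval (v : Fin m → ZMod 2) (hv : (f + p) v ≠ 1) : (f + p) v = 0 := by
    generalize (f + p) v = a at hv ⊢
    decide +revert
  set A : Matrix (Option (Fin m)) {v // (f + p) v = 1} (ZMod 2) :=
    Matrix.of fun o v => eval v.1 (affineCoord m o) with hA
  have hrow : LinearIndependent (ZMod 2) A.row := by
    refine Fintype.linearIndependent_iff.mpr fun c hc => congrFun ?_
    refine eq_zero_of_affine_mul_eq_zero hm hdeg hind hp c fun v => ?_
    by_cases hv : (f + p) v = 1
    · have := congrFun hc ⟨v, hv⟩
      simpa [hA, Matrix.row, hv, smul_eval] using this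
    · rw [hval v hv, mul_zero]
  have hmul : A * A.transpose = 0 := by
    ext o o'
    have hsum := sum_eval_mul_eq_zero (f + p) (affineCoord m o * affineCoord m o') (by
      have := totalDegree_mul (affineCoord m o) (affineCoord m o')
      have := totalDegree_affineCoord_le o
      have := totalDegree_affineCoord_le o'
      omega)
    rw [Matrix.mul_apply, Matrix.zero_apply, ← hsum,
      ← Finset.sum_subset (Finset.subset_univ {v | (f + p) v = 1}) fun v _ hv => by
        rw [hval v (by simpa using hv), mul_zero],
      Finset.sum_subtype (p := fun v => (f + p) v = 1) _ fun v => by simp]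
    refine Finset.sum_congr rfl fun v _ => ?_
    rw [v.2, mul_one, map_mul]
    rfl
  have hcard := Matrix.rank_add_rank_le_card_of_mul_eq_zero hmul
  rw [Matrix.rank_transpose, hrow.rank_matrix, Fintype.card_option, Fintype.card_fin,
    Fintype.card_subtype] at hcard
  change _ ≤ (Finset.univ.filter fun v => (f + p) v = 1).card
  omega
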